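/- arXiv:1602.08617 — 6 statements merged into one kernel-verified Lean document; each statement's English description precedes it below -/
import Mathlib

section
/- Let b > 0, t₀ < T ≤ ∞, and let λ₁, λ₂ : [t₀, T) → (0, ∞) be differentiable functions satisfying −(101/100)·b ≤ λᵢ'(t)·λᵢ(t)² ≤ −(99/100)·b for i = 1, 2 and all t ∈ [t₀, T). If λ₁(t₀)/λ₂(t₀) ≥ 10/9, then λ₁(t)/λ₂(t) ≥ 10/9 for all t ∈ [t₀, T). -/
open Set

/-- if two positive differentiable functions `λ₁, λ₂` on `[t₀, T)`
(`T ∈ (t₀, ∞]`, encoded as an extended real) satisfy the two-sided differential inequality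
`-(101/100)·b ≤ λᵢ'·λᵢ² ≤ -(99/100)·b`, and `λ₁(t₀)/λ₂(t₀) ≥ 10/9`, then
`λ₁(t)/λ₂(t) ≥ 10/9` for all `t ∈ [t₀, T)`. -/
theorem ratio_lemma (b t₀ : ℝ) (hb : 0 < b) (T : EReal) (ht₀T : (t₀ : EReal) < T)
    (lam₁ lam₂ lam₁' lam₂' : ℝ → ℝ)
    (hpos₁ : ∀ t : ℝ, t₀ ≤ t → (t : EReal) < T → 0 < lam₁ t)
    (hpos₂ : ∀ t : ℝ, t₀ ≤ t → (t : EReal) < T → 0 < lam₂ t)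
    (hd₁ : ∀ t : ℝ, t₀ ≤ t → (t : EReal) < T →
      HasDerivWithinAt lam₁ (lam₁' t) {s : ℝ | t₀ ≤ s ∧ (s : EReal) < T} t)
    (hd₂ : ∀ t : ℝ, t₀ ≤ t → (t : EReal) < T →
      HasDerivWithinAt lam₂ (lam₂' t) {s : ℝ | t₀ ≤ s ∧ (s : EReal) < T} t)
    (hineq₁ : ∀ t : ℝ, t₀ ≤ t → (t : EReal) < T →
      -(101/100) * b ≤ lam₁' t * (lam₁ t)^2 ∧ lam₁' t * (lam₁ t)^2 ≤ -(99/100) * b)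
    (hineq₂ : ∀ t : ℝ, t₀ ≤ t → (t : EReal) < T →
      -(101/100) * b ≤ lam₂' t * (lam₂ t)^2 ∧ lam₂' t * (lam₂ t)^2 ≤ -(99/100) * b)
    (hinit : 10/9 ≤ lam₁ t₀ / lam₂ t₀) :
    ∀ t : ℝ, t₀ ≤ t → (t : EReal) < T → 10/9 ≤ lam₁ t / lam₂ t := by
  intro t ht htT
  have hsub : ∀ s ∈ Icc t₀ t, (s : EReal) < T := fun s hs =>
    (EReal.coe_le_coe_iff.mpr hs.2).trans_lt htT
  have hd : ∀ s ∈ Icc t₀ t, HasDerivWithinAt (fun s => 729 * lam₁ s ^ 3 - 1000 * lam₂ s ^ 3)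
      (3 * (729 * (lam₁' s * lam₁ s ^ 2) - 1000 * (lam₂' s * lam₂ s ^ 2))) (Icc t₀ t) s := by
    intro s hs
    have hss : Icc t₀ t ⊆ {s : ℝ | t₀ ≤ s ∧ (s : EReal) < T} := fun r hr => ⟨hr.1, hsub r hr⟩
    have h₁ := (((hd₁ s hs.1 (hsub s hs)).mono hss).fun_pow 3).const_mul 729
    have h₂ := (((hd₂ s hs.1 (hsub s hs)).mono hss).fun_pow 3).const_mul 1000
    refine (h₁.fun_sub h₂).congr_deriv ?_
    norm_num
    ring
  have hmono : MonotoneOn (fun s => 729 * lam₁ s ^ 3 - 1000 * lam₂ s ^ 3) (Icc t₀ t) := by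
    refine monotoneOn_of_hasDerivWithinAt_nonneg (convex_Icc t₀ t)
      (fun s hs => (hd s hs).continuousWithinAt)
      (fun s hs => (hd s (interior_subset hs)).mono interior_subset) fun s hs => ?_
    have hs' := interior_subset hs
    have h₁ := (hineq₁ s hs'.1 (hsub s hs')).1
    have h₂ := (hineq₂ s hs'.1 (hsub s hs')).2
    linarith
  have hle := hmono (left_mem_Icc.mpr ht) (right_mem_Icc.mpr ht) ht
  have hp₂ := hpos₂ t₀ le_rfl ht₀T
  rw [le_div_iff₀ hp₂] at hinit
  rw [le_div_iff₀ (hpos₂ t ht htT)]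
  have hinit3 : (10 / 9 * lam₂ t₀) ^ 3 ≤ lam₁ t₀ ^ 3 := by gcongr
  refine le_of_pow_le_pow_left₀ three_ne_zero (hpos₁ t ht htT).le ?_
  simp only at hle
  rw [mul_pow] at hinit3 ⊢
  linarith
end

section
/- Let ν ∈ (0,1), b > 0, T ∈ (0, ∞], and let λ : [0, T) → (0, ∞) be differentiable with (1−ν)·b ≤ −λ'(t)·λ(t)² ≤ (1+ν)·b for all t ∈ [0, T). Then: (i) T ≤ λ(0)³ / (3(1−ν)b), so in particular T < ∞; (ii) if moreover λ(t) → 0 as t → T⁻, then for all t ∈ [0, T) one has 3(1−ν)·b·(T−t) ≤ λ(t)³ ≤ 3(1+ν)·b·(T−t). -/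
open Set Filter

/-- Between two times of the interval, `λ³` decreases at a rate between `3 * m` and `3 * M` when
`m ≤ -λ' * λ² ≤ M`. -/
theorem cube_sub_cube_mem_Icc {f f' : ℝ → ℝ} {m M s t : ℝ} (hst : s ≤ t)
    (hd : ∀ x ∈ Icc s t, HasDerivWithinAt f (f' x) (Icc s t) x)
    (hf : ∀ x ∈ Icc s t, -(f' x) * f x ^ 2 ∈ Icc m M) :
    f s ^ 3 - f t ^ 3 ∈ Icc (3 * m * (t - s)) (3 * M * (t - s)) := by
  rcases hst.eq_or_lt with rfl | hlt
  · simp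
  obtain ⟨c, hc, hslope⟩ := exists_hasDerivAt_eq_slope (fun x => f x ^ 3)
    (fun x => 3 * f x ^ 2 * f' x) hlt
    (fun x hx => (hd x hx).continuousWithinAt.pow 3)
    (fun x hx => by
      simpa using ((hd x (Ioo_subset_Icc_self hx)).hasDerivAt (Icc_mem_nhds hx.1 hx.2)).fun_pow 3)
  have hts : 0 < t - s := sub_pos.2 hlt
  rw [eq_div_iff hts.ne'] at hslope
  obtain ⟨hm, hM⟩ := hf c (Ioo_subset_Icc_self hc)
  have hm' := mul_le_mul_of_nonneg_right hm hts.le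
  have hM' := mul_le_mul_of_nonneg_right hM hts.le
  constructor <;> linarith

/-- let `ν ∈ (0,1)`, `b > 0`, `T ∈ (0,∞]` (an extended real) and let
`λ : [0,T) → (0,∞)` be differentiable with `(1-ν)b ≤ -λ'λ² ≤ (1+ν)b`. Then
(i) `T ≤ λ(0)³/(3(1-ν)b)` (in particular `T < ∞`), and
(ii) if `T = T'` is (the coercion of) a real number and `λ(t) → 0` as `t → T'⁻`, then
`3(1-ν)b(T'-t) ≤ λ(t)³ ≤ 3(1+ν)b(T'-t)` for all `t ∈ [0,T')`. -/
theorem selfsimilar_rate (ν b : ℝ) (hν : ν ∈ Set.Ioo (0:ℝ) 1) (hb : 0 < b)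
    (T : EReal) (hT : 0 < T)
    (lam lam' : ℝ → ℝ)
    (hpos : ∀ t : ℝ, 0 ≤ t → (t : EReal) < T → 0 < lam t)
    (hd : ∀ t : ℝ, 0 ≤ t → (t : EReal) < T →
      HasDerivWithinAt lam (lam' t) {s : ℝ | 0 ≤ s ∧ (s : EReal) < T} t)
    (hineq : ∀ t : ℝ, 0 ≤ t → (t : EReal) < T →
      (1 - ν) * b ≤ -(lam' t) * (lam t)^2 ∧ -(lam' t) * (lam t)^2 ≤ (1 + ν) * b) :
    T ≤ (((lam 0)^3 / (3 * (1 - ν) * b) : ℝ) : EReal) ∧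
    ∀ T' : ℝ, T = (T' : EReal) →
      Tendsto lam (nhdsWithin T' (Set.Iio T')) (nhds 0) →
      ∀ t : ℝ, 0 ≤ t → t < T' →
        3 * (1 - ν) * b * (T' - t) ≤ (lam t)^3 ∧ (lam t)^3 ≤ 3 * (1 + ν) * b * (T' - t) := by
  obtain ⟨-, hν1⟩ := hν
  have key : ∀ s t : ℝ, 0 ≤ s → s ≤ t → (t : EReal) < T →
      lam s ^ 3 - lam t ^ 3 ∈
        Icc (3 * ((1 - ν) * b) * (t - s)) (3 * ((1 + ν) * b) * (t - s)) := by
    intro s t hs hst htT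
    have hmem : ∀ x ∈ Icc s t, 0 ≤ x ∧ (x : EReal) < T := fun x hx =>
      ⟨hs.trans hx.1, (EReal.coe_le_coe_iff.2 hx.2).trans_lt htT⟩
    exact cube_sub_cube_mem_Icc hst
      (fun x hx => (hd x (hmem x hx).1 (hmem x hx).2).mono hmem)
      (fun x hx => hineq x (hmem x hx).1 (hmem x hx).2)
  have hc : 0 < 3 * (1 - ν) * b := mul_pos (by linarith) hb
  constructor
  · by_contra! hlt
    have h0 : 0 < lam 0 := hpos 0 le_rfl (by simpa using hT)
    have hC : 0 ≤ lam 0 ^ 3 / (3 * (1 - ν) * b) := by positivity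
    have hC_pos := pow_pos (hpos _ hC hlt) 3
    have hC_le := (key 0 _ le_rfl hC hlt).1
    have hC_eq : 3 * ((1 - ν) * b) * (lam 0 ^ 3 / (3 * (1 - ν) * b) - 0) = lam 0 ^ 3 := by
      field_simp
      ring
    linarith
  · rintro T' rfl hlim t ht htT
    have hleft : Tendsto (fun u : ℝ => u) (nhdsWithin T' (Iio T')) (nhds T') :=
      tendsto_id.mono_left nhdsWithin_le_nhds
    have hdiff : Tendsto (fun u => lam t ^ 3 - lam u ^ 3) (nhdsWithin T' (Iio T'))
        (nhds (lam t ^ 3)) := by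
      simpa using (hlim.pow 3).const_sub (lam t ^ 3)
    have hkey : ∀ᶠ u in nhdsWithin T' (Iio T'), lam t ^ 3 - lam u ^ 3 ∈
        Icc (3 * ((1 - ν) * b) * (u - t)) (3 * ((1 + ν) * b) * (u - t)) := by
      filter_upwards [Ioo_mem_nhdsLT htT] with u hu
      exact key t u ht hu.1.le (EReal.coe_lt_coe_iff.2 hu.2)
    rw [mul_assoc 3 (1 - ν) b, mul_assoc 3 (1 + ν) b]
    exact ⟨le_of_tendsto_of_tendsto ((hleft.sub_const t).const_mul _) hdiff
        (hkey.mono fun _ h => h.1),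
      le_of_tendsto_of_tendsto hdiff ((hleft.sub_const t).const_mul _)
        (hkey.mono fun _ h => h.2)⟩
end

section
/- Let ν ∈ (0, 1/2], b > 0, τ₀ > 0, and let λ : [0, τ₀] → (0, ∞) be differentiable with (1−ν)·b ≤ −λ'(τ)·λ(τ)² ≤ (1+ν)·b for all τ ∈ [0, τ₀]. Then for every β > 3 one has ∫₀^{τ₀} λ(τ)^{−β} dτ ≤ 2 / (b·(β−3)·λ(τ₀)^{β−3}). -/
open Set

/-- let `ν ∈ (0,1/2]`, `b > 0`, `τ₀ > 0` and let `λ : [0,τ₀] → (0,∞)` be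
differentiable with `(1-ν)b ≤ -λ'λ² ≤ (1+ν)b` on `[0,τ₀]`. Then for every `β > 3`,
`∫₀^{τ₀} λ(τ)^{-β} dτ ≤ 2/(b(β-3)λ(τ₀)^{β-3})`. -/
theorem integral_negative_power_bound (ν b τ₀ : ℝ)
    (hν : ν ∈ Set.Ioc (0:ℝ) (1/2)) (hb : 0 < b) (hτ₀ : 0 < τ₀)
    (lam lam' : ℝ → ℝ)
    (hpos : ∀ τ ∈ Set.Icc (0:ℝ) τ₀, 0 < lam τ)
    (hd : ∀ τ ∈ Set.Icc (0:ℝ) τ₀, HasDerivWithinAt lam (lam' τ) (Set.Icc (0:ℝ) τ₀) τ)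
    (hineq : ∀ τ ∈ Set.Icc (0:ℝ) τ₀,
      (1 - ν) * b ≤ -(lam' τ) * (lam τ)^2 ∧ -(lam' τ) * (lam τ)^2 ≤ (1 + ν) * b) :
    ∀ β : ℝ, 3 < β →
      (∫ τ in (0:ℝ)..τ₀, (lam τ) ^ (-β)) ≤ 2 / (b * (β - 3) * (lam τ₀) ^ (β - 3)) := by
  intro β hβ
  obtain ⟨-, hν⟩ := hν
  have hβ3 : 0 < β - 3 := by linarith
  have hcont : ContinuousOn lam (Icc 0 τ₀) := fun τ hτ => (hd τ hτ).continuousWithinAt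
  have hcont_rpow (p : ℝ) : ContinuousOn (fun τ => lam τ ^ p) (Icc 0 τ₀) :=
    hcont.rpow_const fun τ hτ => Or.inl (hpos τ hτ).ne'
  have hbound := intervalIntegral.integral_le_sub_of_hasDeriv_right_of_le hτ₀.le
    (g := fun τ => 2 / (b * (β - 3)) * lam τ ^ (-(β - 3)))
    (g' := fun τ => 2 / (b * (β - 3)) * (lam' τ * -(β - 3) * lam τ ^ (-(β - 3) - 1)))
    (φ := fun τ => lam τ ^ (-β))
    ((hcont_rpow _).const_mul _)
    (fun τ hτ => by
      have hτ' := Ioo_subset_Icc_self hτ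
      exact ((((hd τ hτ').hasDerivAt (Icc_mem_nhds hτ.1 hτ.2)).rpow_const
        (Or.inl (hpos τ hτ').ne')).const_mul _).hasDerivWithinAt)
    (hcont_rpow _).integrableOn_Icc
    (fun τ hτ => by
      have hτ' := Ioo_subset_Icc_self hτ
      have hlam := hpos τ hτ'
      have hrpow : lam τ ^ (-(β - 3) - 1) = lam τ ^ (-β) * lam τ ^ 2 := by
        rw [← Real.rpow_natCast, ← Real.rpow_add hlam]
        congr 1
        push_cast
        ring
      have hderiv : b / 2 ≤ -(lam' τ) * lam τ ^ 2 := by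
        nlinarith [(hineq τ hτ').1]
      have hfactor : 1 ≤ 2 / b * (-(lam' τ) * lam τ ^ 2) := by
        rw [div_mul_eq_mul_div, le_div_iff₀ hb]
        linarith
      calc lam τ ^ (-β) ≤ lam τ ^ (-β) * (2 / b * (-(lam' τ) * lam τ ^ 2)) :=
            le_mul_of_one_le_right (Real.rpow_nonneg hlam.le _) hfactor
        _ = _ := by
            rw [hrpow]
            field_simp)
  have hlam₀ := hpos 0 (left_mem_Icc.2 hτ₀.le)
  have hlam₁ := hpos τ₀ (right_mem_Icc.2 hτ₀.le)
  calc (∫ τ in (0:ℝ)..τ₀, lam τ ^ (-β))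
      ≤ 2 / (b * (β - 3)) * lam τ₀ ^ (-(β - 3)) :=
        hbound.trans (sub_le_self _ (by positivity))
    _ = 2 / (b * (β - 3) * lam τ₀ ^ (β - 3)) := by
        rw [Real.rpow_neg hlam₁.le, ← div_eq_mul_inv, div_div]
end

section
/- Let ν = 1/1000. There exists b₀ > 0 such that for every b_c ∈ (0, b₀), every c ≥ 1, every S ∈ (0, ∞], and every differentiable function b : [0, S) → ℝ satisfying |b(0) − b_c| ≤ b_c⁴ and |b'(s) + c·(b(s) − b_c)·b_c| ≤ 2·b_c^{5/2 + 3ν} for all s ∈ [0, S), one has |b(s) − b_c| ≤ b_c^{3/2 + 2ν} for all s ∈ [0, S). -/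
open Set

/-- A function whose derivative is negative whenever it hits the level `M` cannot cross `M` from
below. -/
theorem le_of_hasDerivWithinAt_neg_at_level {f f' : ℝ → ℝ} {a t M : ℝ} (hat : a ≤ t)
    (hf : ∀ x ∈ Icc a t, HasDerivWithinAt f (f' x) (Icc a t) x) (ha : f a ≤ M)
    (hlevel : ∀ x ∈ Icc a t, f x = M → f' x < 0) : f t ≤ M := by
  refine image_le_of_deriv_right_lt_deriv_boundary (f := f) (f' := f') (a := a) (b := t)
    (B := fun _ => M) (B' := fun _ => 0)
    (fun x hx => (hf x hx).continuousWithinAt) (fun x hx => ?_) ha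
    (fun x => hasDerivAt_const x M) (fun x hx => hlevel x (Ico_subset_Icc_self hx))
    (right_mem_Icc.2 hat)
  exact ((hf x (Ico_subset_Icc_self hx)).mono (Icc_subset_Icc_left hx.1)).mono_of_mem_nhdsWithin
    (Icc_mem_nhdsGE hx.2)

/-- with `ν = 1/1000`, there exists `b₀ > 0` such that for every
`b_c ∈ (0,b₀)`, every `c ≥ 1`, every `S ∈ (0,∞]` (an extended real) and every
differentiable `b : [0,S) → ℝ` with `|b(0) - b_c| ≤ b_c⁴` and
`|b'(s) + c(b(s) - b_c)b_c| ≤ 2 b_c^{5/2+3ν}` on `[0,S)`, one has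
`|b(s) - b_c| ≤ b_c^{3/2+2ν}` on `[0,S)`. -/
theorem barrier_bootstrap (ν : ℝ) (hνval : ν = 1/1000) :
    ∃ b₀ : ℝ, 0 < b₀ ∧
      ∀ bc : ℝ, 0 < bc → bc < b₀ →
      ∀ c : ℝ, 1 ≤ c →
      ∀ S : EReal, 0 < S →
      ∀ b b' : ℝ → ℝ,
        (∀ s : ℝ, 0 ≤ s → (s : EReal) < S →
          HasDerivWithinAt b (b' s) {r : ℝ | 0 ≤ r ∧ (r : EReal) < S} s) →
        |b 0 - bc| ≤ bc ^ 4 →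
        (∀ s : ℝ, 0 ≤ s → (s : EReal) < S →
          |b' s + c * (b s - bc) * bc| ≤ 2 * bc ^ ((5:ℝ)/2 + 3 * ν)) →
        ∀ s : ℝ, 0 ≤ s → (s : EReal) < S → |b s - bc| ≤ bc ^ ((3:ℝ)/2 + 2 * ν) := by
  subst hνval
  refine ⟨(1 / 2) ^ (1000 : ℝ), by positivity, ?_⟩
  intro bc hbc hlt c hc S _ b b' hderiv h0 hbound s hs hsS
  have hbc1 : bc ≤ 1 :=
    hlt.le.trans (Real.rpow_le_one (by norm_num) (by norm_num) (by norm_num))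
  have hsmall : bc ^ (1 / 1000 : ℝ) < 1 / 2 := by
    have h := Real.rpow_lt_rpow hbc.le hlt (by norm_num : (0 : ℝ) < 1 / 1000)
    rw [← Real.rpow_mul (by norm_num)] at h
    norm_num at h ⊢
    exact h
  set M : ℝ := bc ^ ((3 : ℝ) / 2 + 2 * (1 / 1000)) with hM
  have hMpos : 0 < M := Real.rpow_pos_of_pos hbc _
  have hforce : 2 * bc ^ ((5 : ℝ) / 2 + 3 * (1 / 1000)) < c * M * bc := by
    have hsplit : bc ^ ((5 : ℝ) / 2 + 3 * (1 / 1000)) = M * bc * bc ^ (1 / 1000 : ℝ) := by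
      rw [hM, ← Real.rpow_add_one hbc.ne', ← Real.rpow_add hbc]
      norm_num
    rw [hsplit]
    have hMbc : 0 < M * bc := mul_pos hMpos hbc
    nlinarith
  have hinit : bc ^ 4 ≤ M := by
    rw [hM, ← Real.rpow_natCast]
    exact Real.rpow_le_rpow_of_exponent_ge hbc hbc1 (by norm_num)
  have hltS : ∀ x ∈ Icc 0 s, (x : EReal) < S := fun x hx =>
    (EReal.coe_le_coe_iff.2 hx.2).trans_lt hsS
  have hd : ∀ x ∈ Icc 0 s, HasDerivWithinAt b (b' x) (Icc 0 s) x := fun x hx =>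
    (hderiv x hx.1 (hltS x hx)).mono fun y hy => ⟨hy.1, hltS y hy⟩
  have h0' := abs_le.1 (h0.trans hinit)
  have upper : b s - bc ≤ M :=
    le_of_hasDerivWithinAt_neg_at_level (f := fun x => b x - bc) (f' := b') hs
      (fun x hx => (hd x hx).sub_const bc) h0'.2 fun x hx hxM => by
        have h := (abs_le.1 (hbound x hx.1 (hltS x hx))).2
        rw [hxM] at h
        linarith
  have lower : -(b s - bc) ≤ M :=
    le_of_hasDerivWithinAt_neg_at_level (f := fun x => -(b x - bc)) (f' := fun x => -b' x) hs
      (fun x hx => ((hd x hx).sub_const bc).neg) (by linarith [h0'.1]) fun x hx hxM => by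
        have h := (abs_le.1 (hbound x hx.1 (hltS x hx))).1
        have hxM' : b x - bc = -M := by linarith
        rw [hxM'] at h
        linarith
  exact abs_le.2 ⟨by linarith, upper⟩
end

section
/- Let q ≥ 1 and let f : ℝ → ℝ be continuously differentiable with compact support. Then (sup_{y∈ℝ} |f(y)|)^{(q+2)/2} ≤ ((q+2)/2) · (∫_ℝ f'(y)² dy)^{1/2} · (∫_ℝ |f(y)|^q dy)^{1/2}. -/
open MeasureTheory

theorem abs_rpow_le_mul_integral_abs_deriv_mul {p : ℝ} (hp : 1 < p) {f : ℝ → ℝ}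
    (hf : ContDiff ℝ 1 f) (hfc : HasCompactSupport f) (y : ℝ) :
    |f y| ^ p ≤ p * ∫ x, |deriv f x| * |f x| ^ (p - 1) := by
  have hg : ContDiff ℝ 1 (fun x ↦ ‖f x‖ ^ p) := hf.norm_rpow hp
  have hgc : HasCompactSupport (fun x ↦ ‖f x‖ ^ p) :=
    hfc.comp_left (g := fun t : ℝ ↦ ‖t‖ ^ p) (by simp [(by linarith : p ≠ 0)])
  have hint : Integrable (fun x ↦ |deriv f x| * |f x| ^ (p - 1)) := by
    refine Continuous.integrable_of_hasCompactSupport ?_ ?_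
    · exact (hf.continuous_deriv le_rfl).abs.mul
        (hf.continuous.abs.rpow_const fun _ ↦ .inr (by linarith))
    · exact hfc.deriv.norm.mul_right
  calc |f y| ^ p = ‖∫ x in Set.Ioi y, deriv (fun x ↦ ‖f x‖ ^ p) x‖ := by
        rw [hgc.integral_Ioi_deriv_eq hg, norm_neg, Real.norm_of_nonneg (by positivity),
          Real.norm_eq_abs]
    _ ≤ ∫ x in Set.Ioi y, p * (|deriv f x| * |f x| ^ (p - 1)) := by
        refine norm_integral_le_of_norm_le (hint.const_mul p).integrableOn (.of_forall fun x ↦ ?_)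
        rw [norm_deriv_eq_norm_fderiv]
        refine (norm_fderiv_norm_rpow_le (hf.differentiable one_ne_zero) hp).trans_eq ?_
        rw [← norm_deriv_eq_norm_fderiv, Real.norm_eq_abs, Real.norm_eq_abs]
        ring
    _ ≤ ∫ x, p * (|deriv f x| * |f x| ^ (p - 1)) :=
        setIntegral_le_integral (hint.const_mul p) (.of_forall fun x ↦ by positivity)
    _ = p * ∫ x, |deriv f x| * |f x| ^ (p - 1) := integral_const_mul _ _

/-- a one-dimensional Gagliardo–Nirenberg/Agmon-type inequality: for `q ≥ 1`
and `f : ℝ → ℝ` continuously differentiable with compact support,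
`(sup |f|)^{(q+2)/2} ≤ ((q+2)/2)·(∫ f'²)^{1/2}·(∫ |f|^q)^{1/2}`. -/
theorem sup_bound_gagliardo_nirenberg (q : ℝ) (hq : 1 ≤ q)
    (f : ℝ → ℝ) (hf : ContDiff ℝ 1 f) (hfc : HasCompactSupport f) :
    (⨆ y : ℝ, |f y|) ^ ((q + 2) / 2) ≤
      ((q + 2) / 2) * (∫ y : ℝ, (deriv f y) ^ 2) ^ ((1:ℝ)/2) *
        (∫ y : ℝ, |f y| ^ q) ^ ((1:ℝ)/2) := by
  have hp : 1 < (q + 2) / 2 := by linarith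
  have hsub : (q + 2) / 2 - 1 = q / 2 := by ring
  have hI : 0 ≤ ∫ y : ℝ, (deriv f y) ^ 2 := integral_nonneg fun _ ↦ by positivity
  have hJ : 0 ≤ ∫ y : ℝ, |f y| ^ q := integral_nonneg fun _ ↦ by positivity
  have hpow : MemLp (fun x ↦ |f x| ^ (q / 2)) (ENNReal.ofReal 2) :=
    (hf.continuous.abs.rpow_const fun _ ↦ .inr (by linarith)).memLp_of_hasCompactSupport
      (hfc.comp_left (g := fun t : ℝ ↦ |t| ^ (q / 2)) (by simp [(by linarith : q ≠ 0)]))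
  have hholder := integral_mul_le_Lp_mul_Lq_of_nonneg Real.HolderConjugate.two_two
    (.of_forall fun x ↦ abs_nonneg (deriv f x)) (.of_forall fun x ↦ by positivity)
    ((hf.continuous_deriv le_rfl).abs.memLp_of_hasCompactSupport (μ := volume) hfc.deriv.norm) hpow
  have hsq (x : ℝ) : (|f x| ^ (q / 2)) ^ (2 : ℝ) = |f x| ^ q := by
    rw [← Real.rpow_mul (abs_nonneg _), div_mul_cancel₀ q two_ne_zero]
  simp only [hsq, Real.rpow_two, sq_abs] at hholder
  rw [← Real.le_rpow_inv_iff_of_pos (Real.iSup_nonneg fun _ ↦ abs_nonneg _) (by positivity)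
    (by linarith)]
  refine ciSup_le fun y ↦ ?_
  rw [Real.le_rpow_inv_iff_of_pos (abs_nonneg _) (by positivity) (by linarith), mul_assoc]
  refine (abs_rpow_le_mul_integral_abs_deriv_mul hp hf hfc y).trans ?_
  rw [hsub]
  gcongr
end

section
/- Let p > 1, T ∈ (0, ∞], and let u : [0, T) × ℝ → ℝ be a smooth solution of ∂ₜu + ∂ₓ(∂ₓₓu + u|u|^{p−1}) = 0 such that for each t, u(t,·) together with all its x-derivatives decays rapidly at spatial infinity, locally uniformly in t. Let g : ℝ → ℝ be smooth and bounded with bounded derivatives up to order three. Then for all t ∈ [0, T): d/dt ∫_ℝ ( (1/2)(∂ₓu)² − (1/(p+1))|u|^{p+1} ) g(x) dx = −(1/2)∫_ℝ (∂ₓₓu + u|u|^{p−1})² g'(x) dx − ∫_ℝ (∂ₓₓu)² g'(x) dx + p∫_ℝ |u|^{p−1} (∂ₓu)² g'(x) dx + (1/2)∫_ℝ (∂ₓu)² g'''(x) dx. -/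
noncomputable section

open Set Filter MeasureTheory

/-- The time domain `[0, T)` for `T ∈ (0, ∞]` (an extended real). -/
def timeDomain (T : EReal) : Set ℝ := {t : ℝ | 0 ≤ t ∧ (t : EReal) < T}

/-- `u` solves the gKdV equation `∂ₜu + ∂ₓ(∂ₓₓu + u|u|^{p-1}) = 0` on `[0,T) × ℝ`. -/
def IsGKdVSolution (p : ℝ) (T : EReal) (u : ℝ → ℝ → ℝ) : Prop :=
  ∀ t ∈ timeDomain T, ∀ x : ℝ,
    deriv (fun s => u s x) t +
      deriv (fun y => deriv (deriv (u t)) y + u t y * |u t y| ^ (p - 1)) x = 0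

/-- For each `t`, `u(t,·)` together with all its `x`-derivatives decays rapidly at spatial
infinity, locally uniformly in `t`. -/
def RapidDecayLocUnif (T : EReal) (u : ℝ → ℝ → ℝ) : Prop :=
  ∀ n k : ℕ, ∀ t₀ ∈ timeDomain T, ∃ ε > 0, ∃ C : ℝ,
    ∀ t ∈ timeDomain T, |t - t₀| < ε → ∀ x : ℝ,
      (1 + |x|) ^ n * |iteratedDeriv k (u t) x| ≤ C

lemma isOpen_coe_lt (T : EReal) : IsOpen {t : ℝ | (t : EReal) < T} :=
  isOpen_lt continuous_coe_real_ereal continuous_const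

lemma timeDomain_mem_nhds {T : EReal} {t : ℝ} (ht : t ∈ timeDomain T) (h0 : 0 < t) :
    timeDomain T ∈ nhds t :=
  inter_mem (Ici_mem_nhds h0) ((isOpen_coe_lt T).mem_nhds ht.2)

lemma convex_timeDomain (T : EReal) : Convex ℝ (timeDomain T) := by
  have : OrdConnected (timeDomain T) :=
    ⟨fun a ha b hb c hc => ⟨ha.1.trans hc.1,
      (EReal.coe_le_coe_iff.2 hc.2).trans_lt hb.2⟩⟩
  exact this.convex

lemma uniqueDiffOn_timeDomain {T : EReal} (hT : 0 < T) : UniqueDiffOn ℝ (timeDomain T) := by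
  refine uniqueDiffOn_convex (convex_timeDomain T) ?_
  obtain ⟨r, hr0, hrT⟩ := EReal.lt_iff_exists_real_btwn.1 hT
  have hr : 0 < r := by exact_mod_cast hr0
  exact ⟨r, mem_interior_iff_mem_nhds.2 (timeDomain_mem_nhds ⟨hr.le, hrT⟩ hr)⟩

/-- Partial differentiation in the second variable preserves smoothness on `s ×ˢ univ`. -/
lemma contDiffOn_deriv_snd {s : Set ℝ} (hs : UniqueDiffOn ℝ s) {v : ℝ → ℝ → ℝ}
    (hv : ContDiffOn ℝ (⊤:ℕ∞) (fun q : ℝ × ℝ => v q.1 q.2) (s ×ˢ univ)) :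
    ContDiffOn ℝ (⊤:ℕ∞) (fun q : ℝ × ℝ => deriv (v q.1) q.2) (s ×ˢ univ) := by
  have h1 := hv.fderivWithin (hs.prod uniqueDiffOn_univ) (m := (⊤:ℕ∞)) le_rfl
  refine (h1.clm_apply (contDiffOn_const (c := ((0:ℝ), (1:ℝ))))).congr ?_
  rintro ⟨t, x⟩ hq
  have hd := ((hv.differentiableOn (by simp)) (t, x) hq).hasFDerivWithinAt
  have hp : HasDerivWithinAt (fun y : ℝ => (t, y)) ((0:ℝ), (1:ℝ)) univ x :=
    ((hasDerivAt_const x t).prodMk (hasDerivAt_id x)).hasDerivWithinAt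
  have := hd.comp_hasDerivWithinAt x hp (fun y _ => ⟨hq.1, mem_univ _⟩)
  exact (hasDerivWithinAt_univ.1 this).deriv

lemma contDiff_slice {s : Set ℝ} {v : ℝ → ℝ → ℝ}
    (hv : ContDiffOn ℝ (⊤:ℕ∞) (fun q : ℝ × ℝ => v q.1 q.2) (s ×ˢ univ)) {t : ℝ} (ht : t ∈ s) :
    ContDiff ℝ (⊤:ℕ∞) (v t) :=
  contDiffOn_univ.1 (hv.comp (contDiff_const.prodMk contDiff_id).contDiffOn
    (fun _ _ => ⟨ht, mem_univ _⟩))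

lemma continuousOn_fst_slice {s : Set ℝ} {v : ℝ → ℝ → ℝ}
    (hv : ContDiffOn ℝ (⊤:ℕ∞) (fun q : ℝ × ℝ => v q.1 q.2) (s ×ˢ univ)) (x : ℝ) :
    ContinuousOn (fun t => v t x) s :=
  hv.continuousOn.comp (continuous_id.prodMk continuous_const).continuousOn
    (fun _ ht => ⟨ht, mem_univ _⟩)

lemma hasDerivAt_mul_abs_rpow {p : ℝ} (hp : 1 < p) (y : ℝ) :
    HasDerivAt (fun y : ℝ => y * |y| ^ (p - 1)) (p * |y| ^ (p - 1)) y := by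
  rcases eq_or_ne y 0 with rfl | hy
  · rw [hasDerivAt_iff_tendsto_slope]
    have hc : Continuous fun y : ℝ => |y| ^ (p - 1) :=
      continuous_abs.rpow_const fun _ => Or.inr (by linarith)
    have h0 : p * |(0:ℝ)| ^ (p - 1) = |(0:ℝ)| ^ (p - 1) := by
      rw [abs_zero, Real.zero_rpow (by linarith)]; simp
    rw [h0]
    refine (hc.continuousAt.tendsto.mono_left nhdsWithin_le_nhds).congr' ?_
    filter_upwards [self_mem_nhdsWithin] with z hz
    have : z ≠ 0 := hz
    simp [slope_def_field]
    field_simp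
  · have h1 := (hasDerivAt_id y).mul
      ((hasDerivAt_abs hy).rpow_const (p := p - 1) (Or.inl (abs_ne_zero.2 hy)))
    refine h1.congr_deriv ?_
    have hsgn : y * (SignType.sign y : ℝ) = |y| := self_mul_sign y
    have habs : |y| * |y| ^ (p - 1 - 1) = |y| ^ (p - 1) := by
      rw [Real.rpow_sub_one (abs_ne_zero.2 hy) (p - 1)]
      field_simp
    simp only [id]
    linear_combination (p - 1) * |y| ^ (p - 1 - 1) * hsgn + (p - 1) * habs

lemma hasDerivAt_abs_rpow_add_one {p : ℝ} (hp : 1 < p) (y : ℝ) :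
    HasDerivAt (fun y : ℝ => 1 / (p + 1) * |y| ^ (p + 1)) (y * |y| ^ (p - 1)) y := by
  refine ((hasDerivAt_abs_rpow y (p := p + 1) (by linarith)).const_mul (1 / (p + 1))).congr_deriv ?_
  have : p + 1 ≠ 0 := by linarith
  rw [show p + 1 - 2 = p - 1 by ring]
  field_simp

/-- Up to and including `t = 0`, a smooth solution has the time derivative prescribed by the
equation, as a derivative within the time domain. -/
lemma IsGKdVSolution.hasDerivWithinAt {p : ℝ} (hp : 1 < p) {T : EReal} (hT : 0 < T)
    {u : ℝ → ℝ → ℝ}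
    (hsmooth : ContDiffOn ℝ (⊤:ℕ∞) (fun q : ℝ × ℝ => u q.1 q.2) (timeDomain T ×ˢ univ))
    (hsol : IsGKdVSolution p T u) {t : ℝ} (ht : t ∈ timeDomain T) (x : ℝ) :
    HasDerivWithinAt (fun s => u s x)
      (-(deriv (deriv (deriv (u t))) x + p * |u t x| ^ (p - 1) * deriv (u t) x))
      (timeDomain T) t := by
  have hU := uniqueDiffOn_timeDomain hT
  have h1 := contDiffOn_deriv_snd hU hsmooth
  have h2 := contDiffOn_deriv_snd (v := fun t => deriv (u t)) hU h1
  have h3 := contDiffOn_deriv_snd (v := fun t => deriv (deriv (u t))) hU h2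
  have hdiff : DifferentiableOn ℝ (fun s => u s x) (timeDomain T) :=
    (hsmooth.differentiableOn (by simp)).comp
      (differentiable_id.prodMk (differentiable_const _)).differentiableOn
      (fun _ ht => ⟨ht, mem_univ _⟩)
  have hder : ∀ s ∈ timeDomain T, deriv (fun s => u s x) s =
      -(deriv (deriv (deriv (u s))) x + p * |u s x| ^ (p - 1) * deriv (u s) x) := by
    intro s hs
    have hd0 := ((contDiff_slice hsmooth hs).differentiable (by simp) x).hasDerivAt
    have hd2 := ((contDiff_slice (v := fun t => deriv (deriv (u t))) h2 hs).differentiable (by simp) x).hasDerivAt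
    have := (hd2.add ((hasDerivAt_mul_abs_rpow hp (u s x)).comp x hd0)).deriv
    rw [← this]
    exact eq_neg_of_add_eq_zero_left (hsol s hs x)
  rcases ht.1.eq_or_lt with rfl | h0
  · refine (hasDerivWithinAt_Ici_of_tendsto_deriv hdiff
      ((continuousOn_fst_slice hsmooth x) 0 ht) ?_ ?_).mono (fun s hs => hs.1)
    · exact inter_mem (mem_of_superset self_mem_nhdsWithin Ioi_subset_Ici_self)
        (mem_nhdsWithin_of_mem_nhds ((isOpen_coe_lt T).mem_nhds ht.2))
    · have hmem : timeDomain T ∈ nhdsWithin (0:ℝ) (Ioi 0) :=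
        inter_mem (mem_of_superset self_mem_nhdsWithin Ioi_subset_Ici_self)
          (mem_nhdsWithin_of_mem_nhds ((isOpen_coe_lt T).mem_nhds ht.2))
      have hcont : ContinuousOn (fun s =>
          -(deriv (deriv (deriv (u s))) x + p * |u s x| ^ (p - 1) * deriv (u s) x))
          (timeDomain T) :=
        ((continuousOn_fst_slice (v := fun t => deriv (deriv (deriv (u t)))) h3 x).add ((continuousOn_const.mul
          ((continuousOn_fst_slice hsmooth x).abs.rpow_const
            fun _ _ => Or.inr (by linarith))).mul (continuousOn_fst_slice (v := fun t => deriv (u t)) h1 x))).neg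
      refine ((hcont 0 ht).tendsto.mono_left (nhdsWithin_le_of_mem hmem)).congr' ?_
      filter_upwards [hmem] with s hs using (hder s hs).symm
  · rw [← hder t ht]
    exact (hdiff.differentiableAt (timeDomain_mem_nhds ht h0)).hasDerivAt.hasDerivWithinAt

/-- Continuous functions bounded by a multiple of the integrable weight `(1 + x²)⁻¹`. -/
def IsDecaying (f : ℝ → ℝ) : Prop :=
  Continuous f ∧ ∃ C, ∀ x, |f x| ≤ C * (1 + x ^ 2)⁻¹

/-- Bounded continuous functions. -/
def IsContBounded (f : ℝ → ℝ) : Prop :=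
  Continuous f ∧ ∃ C, ∀ x, |f x| ≤ C

lemma inv_one_add_sq_le_one (x : ℝ) : (1 + x ^ 2)⁻¹ ≤ 1 :=
  inv_le_one_of_one_le₀ (by nlinarith [sq_nonneg x])

lemma IsDecaying.integrable {f : ℝ → ℝ} (hf : IsDecaying f) : Integrable f := by
  obtain ⟨hc, C, hC⟩ := hf
  exact (integrable_inv_one_add_sq.const_mul C).mono' hc.aestronglyMeasurable
    (Eventually.of_forall hC)

lemma IsDecaying.isContBounded {f : ℝ → ℝ} (hf : IsDecaying f) : IsContBounded f := by
  obtain ⟨hc, C, hC⟩ := hf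
  have hC0 : 0 ≤ C := by simpa using (abs_nonneg _).trans (hC 0)
  exact ⟨hc, C, fun x => (hC x).trans (mul_le_of_le_one_right hC0 (inv_one_add_sq_le_one x))⟩

lemma IsDecaying.mul {f h : ℝ → ℝ} (hf : IsDecaying f) (hh : IsContBounded h) :
    IsDecaying fun x => f x * h x := by
  obtain ⟨hc, C, hC⟩ := hf
  obtain ⟨hc', C', hC'⟩ := hh
  refine ⟨hc.mul hc', C * C', fun x => ?_⟩
  rw [abs_mul]
  calc |f x| * |h x| ≤ (C * (1 + x ^ 2)⁻¹) * C' :=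
        mul_le_mul (hC x) (hC' x) (abs_nonneg _) ((abs_nonneg _).trans (hC x))
    _ = C * C' * (1 + x ^ 2)⁻¹ := by ring

lemma IsDecaying.const_mul {f : ℝ → ℝ} (hf : IsDecaying f) (c : ℝ) :
    IsDecaying fun x => c * f x := by
  simpa only [mul_comm] using hf.mul (h := fun _ => c) ⟨continuous_const, |c|, fun _ => le_rfl⟩

lemma IsDecaying.add {f h : ℝ → ℝ} (hf : IsDecaying f) (hh : IsDecaying h) :
    IsDecaying fun x => f x + h x := by
  obtain ⟨hc, C, hC⟩ := hf
  obtain ⟨hc', C', hC'⟩ := hh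
  refine ⟨hc.add hc', C + C', fun x => (abs_add_le _ _).trans ?_⟩
  rw [add_mul]
  exact add_le_add (hC x) (hC' x)

lemma IsDecaying.neg {f : ℝ → ℝ} (hf : IsDecaying f) : IsDecaying fun x => -f x := by
  simpa using hf.const_mul (-1)

lemma IsDecaying.sub {f h : ℝ → ℝ} (hf : IsDecaying f) (hh : IsDecaying h) :
    IsDecaying fun x => f x - h x := by
  simpa only [sub_eq_add_neg] using hf.add hh.neg

lemma IsContBounded.abs_rpow {f : ℝ → ℝ} (hf : IsContBounded f) {r : ℝ} (hr : 0 ≤ r) :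
    IsContBounded fun x => |f x| ^ r := by
  obtain ⟨hc, C, hC⟩ := hf
  refine ⟨hc.abs.rpow_const fun _ => Or.inr hr, C ^ r, fun x => ?_⟩
  rw [abs_of_nonneg (Real.rpow_nonneg (abs_nonneg _) _)]
  exact Real.rpow_le_rpow (abs_nonneg _) (hC x) hr

lemma abs_rpow_add_one_eq {p : ℝ} (hp : 1 < p) (y : ℝ) :
    |y| ^ (p + 1) = y * |y| ^ (p - 1) * y := by
  rcases eq_or_ne y 0 with rfl | hy
  · simp [Real.zero_rpow (show p + 1 ≠ 0 by linarith)]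
  · rw [show p + 1 = (p - 1) + 2 by ring, Real.rpow_add (abs_pos.2 hy),
      show (2:ℝ) = ((2:ℕ):ℝ) by norm_num, Real.rpow_natCast, sq_abs]
    ring

/-- Integration by parts in space: the formal time derivative of the localized energy. -/
lemma integral_localized_energy_flux {p : ℝ} (hp : 1 < p)
    {v v₁ v₂ v₃ g g₁ g₂ g₃ : ℝ → ℝ}
    (hv : ∀ x, HasDerivAt v (v₁ x) x) (hv₁ : ∀ x, HasDerivAt v₁ (v₂ x) x)
    (hv₂ : ∀ x, HasDerivAt v₂ (v₃ x) x)
    (hg : ∀ x, HasDerivAt g (g₁ x) x) (hg₁ : ∀ x, HasDerivAt g₁ (g₂ x) x)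
    (hg₂ : ∀ x, HasDerivAt g₂ (g₃ x) x)
    (d : IsDecaying v) (d₁ : IsDecaying v₁) (d₂ : IsDecaying v₂) (d₃ : IsDecaying v₃)
    (b : IsContBounded g) (b₁ : IsContBounded g₁) (b₂ : IsContBounded g₂)
    (b₃ : IsContBounded g₃) :
    ∫ x, ((v₃ x + p * |v x| ^ (p - 1) * v₁ x) * (v₂ x * g x + v₁ x * g₁ x)
        + v x * |v x| ^ (p - 1) * (v₃ x + p * |v x| ^ (p - 1) * v₁ x) * g x)
      = -(1/2) * (∫ x, (v₂ x + v x * |v x| ^ (p - 1)) ^ 2 * g₁ x)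
        - (∫ x, v₂ x ^ 2 * g₁ x)
        + p * (∫ x, |v x| ^ (p - 1) * v₁ x ^ 2 * g₁ x)
        + (1/2) * (∫ x, v₁ x ^ 2 * g₃ x) := by
  have ba : IsContBounded fun x => |v x| ^ (p - 1) :=
    d.isContBounded.abs_rpow (by linarith)
  have df := d.mul ba
  have dF := d₂.add df
  have dFx : IsDecaying fun x => v₃ x + p * |v x| ^ (p - 1) * v₁ x := by
    simpa only [mul_assoc, mul_comm (v₁ _)] using d₃.add ((d₁.mul ba).const_mul p)
  have hf : ∀ x, HasDerivAt (fun x => v x * |v x| ^ (p - 1))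
      (p * |v x| ^ (p - 1) * v₁ x) x :=
    fun x => (hasDerivAt_mul_abs_rpow hp (v x)).comp x (hv x)
  have i1 : Integrable fun x => (v₂ x + v x * |v x| ^ (p - 1)) ^ 2 * g₁ x := by
    simpa only [sq] using ((dF.mul dF.isContBounded).mul b₁).integrable
  have i2 : Integrable fun x => v₂ x ^ 2 * g₁ x := by
    simpa only [sq] using ((d₂.mul d₂.isContBounded).mul b₁).integrable
  have i3 : Integrable fun x => |v x| ^ (p - 1) * v₁ x ^ 2 * g₁ x := by
    simpa only [sq, mul_comm (|v _| ^ (p - 1))] using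
      (((d₁.mul d₁.isContBounded).mul ba).mul b₁).integrable
  have i4 : Integrable fun x => v₁ x ^ 2 * g₃ x := by
    simpa only [sq] using ((d₁.mul d₁.isContBounded).mul b₃).integrable
  have iL : Integrable fun x =>
      (v₃ x + p * |v x| ^ (p - 1) * v₁ x) * (v₂ x * g x + v₁ x * g₁ x)
        + v x * |v x| ^ (p - 1) * (v₃ x + p * |v x| ^ (p - 1) * v₁ x) * g x :=
    ((dFx.mul ((d₂.mul b).add (d₁.mul b₁)).isContBounded).add
      ((df.mul dFx.isContBounded).mul b)).integrable
  have iH : Integrable fun x => (1/2) * ((v₂ x + v x * |v x| ^ (p - 1))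
      * (v₂ x + v x * |v x| ^ (p - 1)) * g x)
      + v₂ x * v₁ x * g₁ x - (1/2) * (v₁ x * v₁ x * g₂ x) :=
    (((((dF.mul dF.isContBounded).mul b).const_mul _).add
      ((d₂.mul d₁.isContBounded).mul b₁)).sub
      (((d₁.mul d₁.isContBounded).mul b₂).const_mul _)).integrable
  have iR := (((i1.const_mul (-(1/2))).sub i2).add (i3.const_mul p)).add (i4.const_mul (1/2))
  have key := integral_eq_zero_of_hasDerivAt_of_integrable (fun x => by
    have hF := (hv₂ x).add (hf x)
    refine ((((hF.mul hF).mul (hg x)).const_mul (1/2)).add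
      (((hv₂ x).mul (hv₁ x)).mul (hg₁ x))
      |>.sub ((((hv₁ x).mul (hv₁ x)).mul (hg₂ x)).const_mul (1/2))).congr_deriv
      (g' := (v₃ x + p * |v x| ^ (p - 1) * v₁ x) * (v₂ x * g x + v₁ x * g₁ x)
        + v x * |v x| ^ (p - 1) * (v₃ x + p * |v x| ^ (p - 1) * v₁ x) * g x
        - (-(1/2) * ((v₂ x + v x * |v x| ^ (p - 1)) ^ 2 * g₁ x) - v₂ x ^ 2 * g₁ x
          + p * (|v x| ^ (p - 1) * v₁ x ^ 2 * g₁ x) + (1/2) * (v₁ x ^ 2 * g₃ x))) ?_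
    simp only [Pi.add_apply, Pi.mul_apply]
    ring) (iL.sub iR) iH
  rw [integral_sub' iL iR, sub_eq_zero] at key
  rw [key, integral_add' (((i1.const_mul _).sub i2).add (i3.const_mul p)) (i4.const_mul _),
    integral_add' ((i1.const_mul _).sub i2) (i3.const_mul p), integral_sub' (i1.const_mul _) i2]
  simp only [integral_const_mul]

/-- The difference of the localized energies of two profiles, with the spatial derivative of
the difference of the profiles removed by an integration by parts. -/
lemma localized_energy_sub {p : ℝ} (hp : 1 < p)
    {v v₁ v₂ w w₁ w₂ g g₁ : ℝ → ℝ}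
    (hv : ∀ x, HasDerivAt v (v₁ x) x) (hv₁ : ∀ x, HasDerivAt v₁ (v₂ x) x)
    (hw : ∀ x, HasDerivAt w (w₁ x) x) (hw₁ : ∀ x, HasDerivAt w₁ (w₂ x) x)
    (hg : ∀ x, HasDerivAt g (g₁ x) x)
    (d : IsDecaying v) (d₁ : IsDecaying v₁) (d₂ : IsDecaying v₂)
    (e : IsDecaying w) (e₁ : IsDecaying w₁) (e₂ : IsDecaying w₂)
    (b : IsContBounded g) (b₁ : IsContBounded g₁) :
    (∫ x, ((1/2) * v₁ x ^ 2 - (1/(p+1)) * |v x| ^ (p+1)) * g x)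
      - (∫ x, ((1/2) * w₁ x ^ 2 - (1/(p+1)) * |w x| ^ (p+1)) * g x)
      = ∫ x, (-(1/2) * (v x - w x) * ((v₂ x + w₂ x) * g x + (v₁ x + w₁ x) * g₁ x)
        - ((1/(p+1)) * |v x| ^ (p+1) - (1/(p+1)) * |w x| ^ (p+1)) * g x) := by
  have hG : ∀ {f : ℝ → ℝ}, IsDecaying f → IsDecaying fun x => (1/(p+1)) * |f x| ^ (p+1) := by
    intro f hf
    simp only [abs_rpow_add_one_eq hp]
    exact ((hf.mul (hf.isContBounded.abs_rpow (by linarith))).mul hf.isContBounded).const_mul _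
  have hE : ∀ {f f₁ : ℝ → ℝ}, IsDecaying f → IsDecaying f₁ →
      Integrable fun x => ((1/2) * f₁ x ^ 2 - (1/(p+1)) * |f x| ^ (p+1)) * g x := by
    intro f f₁ hf hf₁
    simp only [sq]
    exact ((((hf₁.mul hf₁.isContBounded).const_mul _).sub (hG hf)).mul b).integrable
  have iK : Integrable fun x =>
      -(1/2) * (v x - w x) * ((v₂ x + w₂ x) * g x + (v₁ x + w₁ x) * g₁ x)
        - ((1/(p+1)) * |v x| ^ (p+1) - (1/(p+1)) * |w x| ^ (p+1)) * g x :=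
    ((((d.sub e).const_mul _).mul
      (((d₂.add e₂).mul b).add ((d₁.add e₁).mul b₁)).isContBounded).sub
      (((hG d).sub (hG e)).mul b)).integrable
  have iH : Integrable fun x => (1/2) * ((v x - w x) * (v₁ x + w₁ x) * g x) :=
    ((((d.sub e).mul (d₁.add e₁).isContBounded).mul b).const_mul _).integrable
  have key := integral_eq_zero_of_hasDerivAt_of_integrable (fun x => by
    refine (((((hv x).sub (hw x)).mul ((hv₁ x).add (hw₁ x))).mul (hg x)).const_mul
      (1/2)).congr_deriv
      (g' := (((1/2) * v₁ x ^ 2 - (1/(p+1)) * |v x| ^ (p+1)) * g x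
        - ((1/2) * w₁ x ^ 2 - (1/(p+1)) * |w x| ^ (p+1)) * g x)
        - (-(1/2) * (v x - w x) * ((v₂ x + w₂ x) * g x + (v₁ x + w₁ x) * g₁ x)
          - ((1/(p+1)) * |v x| ^ (p+1) - (1/(p+1)) * |w x| ^ (p+1)) * g x)) ?_
    simp only [Pi.add_apply, Pi.mul_apply, Pi.sub_apply]
    ring) (((hE d d₁).sub (hE e e₁)).sub iK) iH
  rw [integral_sub' ((hE d d₁).sub (hE e e₁)) iK, integral_sub' (hE d d₁) (hE e e₁),
    sub_eq_zero] at key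
  exact key

/-- Locally uniform bounds on finitely many spatial derivatives by the weight `(1 + x²)⁻¹`. -/
lemma RapidDecayLocUnif.exists_uniform_bound {T : EReal} {u : ℝ → ℝ → ℝ}
    (hdecay : RapidDecayLocUnif T u) {t₀ : ℝ} (ht₀ : t₀ ∈ timeDomain T) (N : ℕ) :
    ∃ ε > 0, ∃ K, 0 ≤ K ∧ ∀ t ∈ timeDomain T, |t - t₀| < ε → ∀ k < N, ∀ x,
      |iteratedDeriv k (u t) x| ≤ K * (1 + x ^ 2)⁻¹ := by
  induction N with
  | zero => exact ⟨1, one_pos, 0, le_rfl, fun _ _ _ k hk => absurd hk (Nat.not_lt_zero k)⟩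
  | succ N ih =>
    obtain ⟨ε, hε, K, hK, h⟩ := ih
    obtain ⟨δ, hδ, C, hC⟩ := hdecay 2 N t₀ ht₀
    refine ⟨min ε δ, lt_min hε hδ, max K C, hK.trans (le_max_left _ _), ?_⟩
    intro t ht htt k hk x
    have hw : 0 < 1 + x ^ 2 := by positivity
    rcases Nat.lt_succ_iff_lt_or_eq.1 hk with hk | rfl
    · exact (h t ht (htt.trans_le (min_le_left _ _)) k hk x).trans
        (mul_le_mul_of_nonneg_right (le_max_left _ _) (inv_nonneg.2 hw.le))
    · rw [← div_eq_mul_inv, le_div_iff₀ hw, mul_comm]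
      have hsq : 1 + x ^ 2 ≤ (1 + |x|) ^ 2 := by
        nlinarith [sq_abs x, abs_nonneg x]
      exact ((mul_le_mul_of_nonneg_right hsq (abs_nonneg _)).trans
        (hC t ht (htt.trans_le (min_le_right _ _)) x)).trans (le_max_right _ _)

/-- Differentiation under the integral sign for the localized energy. The mixed derivative
`∂ₜ∂ₓu` does not enter. -/
lemma hasDerivWithinAt_localized_energy {p : ℝ} (hp : 1 < p) {S : Set ℝ} (hS : Convex ℝ S)
    {u v₁ v₂ u' : ℝ → ℝ → ℝ} {g g₁ : ℝ → ℝ} {t ε K : ℝ} (ht : t ∈ S) (hε : 0 < ε)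
    (hut : ∀ s ∈ S, ∀ x, HasDerivWithinAt (fun s => u s x) (u' s x) S s)
    (hu : ∀ s ∈ S, ∀ x, HasDerivAt (u s) (v₁ s x) x)
    (hv₁ : ∀ s ∈ S, ∀ x, HasDerivAt (v₁ s) (v₂ s x) x)
    (hv₂ : ∀ s ∈ S, Continuous (v₂ s))
    (hc₁ : ∀ x, ContinuousWithinAt (fun s => v₁ s x) S t)
    (hc₂ : ∀ x, ContinuousWithinAt (fun s => v₂ s x) S t)
    (hg : ∀ x, HasDerivAt g (g₁ x) x)
    (b : IsContBounded g) (b₁ : IsContBounded g₁)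
    (bu : ∀ s ∈ S, |s - t| < ε → ∀ x, |u s x| ≤ K * (1 + x ^ 2)⁻¹)
    (bv₁ : ∀ s ∈ S, |s - t| < ε → ∀ x, |v₁ s x| ≤ K * (1 + x ^ 2)⁻¹)
    (bv₂ : ∀ s ∈ S, |s - t| < ε → ∀ x, |v₂ s x| ≤ K * (1 + x ^ 2)⁻¹)
    (bu' : ∀ s ∈ S, |s - t| < ε → ∀ x, |u' s x| ≤ K * (1 + x ^ 2)⁻¹) :
    HasDerivWithinAt
      (fun s => ∫ x, ((1/2) * v₁ s x ^ 2 - (1/(p+1)) * |u s x| ^ (p+1)) * g x)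
      (∫ x, (-u' t x * (v₂ t x * g x + v₁ t x * g₁ x)
        - u t x * |u t x| ^ (p - 1) * u' t x * g x)) S t := by
  have hw : ∀ x : ℝ, 0 < (1 + x ^ 2)⁻¹ := fun x => by positivity
  have hK : 0 ≤ K := by
    simpa using (abs_nonneg _).trans (bu t ht (by simpa using hε) 0)
  have hKw : ∀ x : ℝ, K * (1 + x ^ 2)⁻¹ ≤ K := fun x =>
    mul_le_of_le_one_right hK (inv_one_add_sq_le_one x)
  obtain ⟨hgc, B, hB⟩ := id b
  obtain ⟨hg₁c, B₁, hB₁⟩ := id b₁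
  have hB0 : 0 ≤ B := (abs_nonneg _).trans (hB 0)
  have hB₁0 : 0 ≤ B₁ := (abs_nonneg _).trans (hB₁ 0)
  let J : Set ℝ := S ∩ Metric.ball t ε
  have hJ : Convex ℝ J := hS.inter (convex_ball t ε)
  have hJt : t ∈ J := ⟨ht, Metric.mem_ball_self hε⟩
  have hJmem : ∀ s ∈ J, s ∈ S ∧ |s - t| < ε := fun s hs =>
    ⟨hs.1, by simpa [Real.dist_eq] using hs.2⟩
  have hJev : ∀ᶠ s in nhdsWithin t (S \ {t}), s ∈ J ∧ s ≠ t := by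
    filter_upwards [self_mem_nhdsWithin,
      mem_nhdsWithin_of_mem_nhds (Metric.ball_mem_nhds t hε)] with s h1 h2
    exact ⟨⟨h1.1, h2⟩, h1.2⟩
  have hGt : ∀ s ∈ S, ∀ x, HasDerivWithinAt (fun s => 1 / (p + 1) * |u s x| ^ (p + 1))
      (u s x * |u s x| ^ (p - 1) * u' s x) S s := fun s hs x =>
    HasDerivAt.comp_hasDerivWithinAt (h₂ := fun y => 1 / (p + 1) * |y| ^ (p + 1)) s
      (hasDerivAt_abs_rpow_add_one hp (u s x)) (hut s hs x)
  have lip_u : ∀ s ∈ J, ∀ x, |u s x - u t x| ≤ K * (1 + x ^ 2)⁻¹ * |s - t| := by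
    intro s hs x
    exact hJ.norm_image_sub_le_of_norm_hasDerivWithin_le
      (fun r hr => (hut r hr.1 x).mono inter_subset_left)
      (fun r hr => bu' r hr.1 (hJmem r hr).2 x) hJt hs
  have lip_G : ∀ s ∈ J, ∀ x,
      |1 / (p + 1) * |u s x| ^ (p + 1) - 1 / (p + 1) * |u t x| ^ (p + 1)|
        ≤ K * K ^ (p - 1) * (K * (1 + x ^ 2)⁻¹) * |s - t| := by
    intro s hs x
    refine hJ.norm_image_sub_le_of_norm_hasDerivWithin_le
      (fun r hr => (hGt r hr.1 x).mono inter_subset_left) (fun r hr => ?_) hJt hs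
    have h1 := (bu r hr.1 (hJmem r hr).2 x).trans (hKw x)
    rw [Real.norm_eq_abs, abs_mul, abs_mul, abs_of_nonneg (Real.rpow_nonneg (abs_nonneg _) _)]
    have h2 : |u r x| ^ (p - 1) ≤ K ^ (p - 1) :=
      Real.rpow_le_rpow (abs_nonneg _) h1 (by linarith)
    have h3 := bu' r hr.1 (hJmem r hr).2 x
    gcongr
  have dec : ∀ {φ : ℝ → ℝ → ℝ}, (∀ s ∈ S, Continuous (φ s)) →
      (∀ s ∈ S, |s - t| < ε → ∀ x, |φ s x| ≤ K * (1 + x ^ 2)⁻¹) → ∀ s ∈ J, IsDecaying (φ s) :=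
    fun hc hb s hs => ⟨hc s hs.1, K, hb s hs.1 (hJmem s hs).2⟩
  have cont {f f' : ℝ → ℝ} (h : ∀ x, HasDerivAt f (f' x) x) : Continuous f :=
    continuous_iff_continuousAt.2 fun x => (h x).continuousAt
  have du := dec (fun s hs => cont (hu s hs)) bu
  have dv₁ := dec (fun s hs => cont (hv₁ s hs)) bv₁
  have dv₂ := dec hv₂ bv₂
  rw [hasDerivWithinAt_iff_tendsto_slope]
  let Q : ℝ → ℝ → ℝ := fun s x =>
    -(1/2) * (u s x - u t x) * ((v₂ s x + v₂ t x) * g x + (v₁ s x + v₁ t x) * g₁ x)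
      - ((1/(p+1)) * |u s x| ^ (p+1) - (1/(p+1)) * |u t x| ^ (p+1)) * g x
  have hQ : ∀ s ∈ J,
      slope (fun s => ∫ x, ((1/2) * v₁ s x ^ 2 - (1/(p+1)) * |u s x| ^ (p+1)) * g x) t s
        = ∫ x, (s - t)⁻¹ * Q s x := by
    intro s hs
    rw [integral_const_mul, slope_def_module, smul_eq_mul,
      localized_energy_sub hp (hu s hs.1) (hv₁ s hs.1) (hu t ht) (hv₁ t ht) hg
        (du s hs) (dv₁ s hs) (dv₂ s hs) (du t hJt) (dv₁ t hJt) (dv₂ t hJt) b b₁]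
  refine Tendsto.congr' (f₁ := fun s => ∫ x, (s - t)⁻¹ * Q s x)
    (hJev.mono fun s hs => (hQ s hs.1).symm) ?_
  let M : ℝ := (1/2) * K * (2 * K * B + 2 * K * B₁) + K * K ^ (p - 1) * K * B
  refine tendsto_integral_filter_of_dominated_convergence
    (fun x => M * (1 + x ^ 2)⁻¹) ?_ ?_ (integrable_inv_one_add_sq.const_mul M) ?_
  · filter_upwards [hJev] with s hs
    have c1 := (du s hs.1).1
    have c2 := (dv₁ s hs.1).1
    have c3 := (dv₂ s hs.1).1
    have c4 := (du t hJt).1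
    have c5 := (dv₁ t hJt).1
    have c6 := (dv₂ t hJt).1
    have r1 : Continuous fun x => |u s x| ^ (p + 1) :=
      c1.abs.rpow_const fun _ => Or.inr (by linarith)
    have r2 : Continuous fun x => |u t x| ^ (p + 1) :=
      c4.abs.rpow_const fun _ => Or.inr (by linarith)
    have : Continuous fun x => (s - t)⁻¹ * Q s x := by
      simp only [Q]
      fun_prop
    exact this.aestronglyMeasurable
  · filter_upwards [hJev] with s hs
    refine Eventually.of_forall fun x => ?_
    obtain ⟨hsJ, hne⟩ := hs
    have hpos : 0 < |s - t| := abs_pos.2 (sub_ne_zero.2 hne)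
    rw [Real.norm_eq_abs, abs_mul, abs_inv, inv_mul_le_iff₀ hpos]
    have e1 := lip_u s hsJ x
    have e2 := lip_G s hsJ x
    have a1 := (bv₁ s hsJ.1 (hJmem s hsJ).2 x).trans (hKw x)
    have a2 := (bv₂ s hsJ.1 (hJmem s hsJ).2 x).trans (hKw x)
    have a3 := (bv₁ t ht (hJmem t hJt).2 x).trans (hKw x)
    have a4 := (bv₂ t ht (hJmem t hJt).2 x).trans (hKw x)
    have f1 : |(v₂ s x + v₂ t x) * g x + (v₁ s x + v₁ t x) * g₁ x|
        ≤ 2 * K * B + 2 * K * B₁ := by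
      refine (abs_add_le _ _).trans ?_
      rw [abs_mul, abs_mul]
      have s1 : |v₂ s x + v₂ t x| ≤ 2 * K := (abs_add_le _ _).trans (by linarith)
      have s2 : |v₁ s x + v₁ t x| ≤ 2 * K := (abs_add_le _ _).trans (by linarith)
      have := hB x
      have := hB₁ x
      gcongr
    calc |Q s x| ≤ (1/2) * |u s x - u t x|
            * |(v₂ s x + v₂ t x) * g x + (v₁ s x + v₁ t x) * g₁ x|
          + |(1/(p+1)) * |u s x| ^ (p+1) - (1/(p+1)) * |u t x| ^ (p+1)| * |g x| := by
          refine (abs_sub _ _).trans (le_of_eq ?_)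
          rw [abs_mul, abs_mul, abs_mul, abs_neg, abs_of_pos (by norm_num : (0:ℝ) < 1/2)]
      _ ≤ (1/2) * (K * (1 + x ^ 2)⁻¹ * |s - t|) * (2 * K * B + 2 * K * B₁)
          + K * K ^ (p - 1) * (K * (1 + x ^ 2)⁻¹) * |s - t| * B := by
          have := hB x
          gcongr
      _ = |s - t| * (M * (1 + x ^ 2)⁻¹) := by
          simp only [M]
          ring
  · refine Eventually.of_forall fun x => ?_
    have l1 := hasDerivWithinAt_iff_tendsto_slope.1 (hut t ht x)
    have l2 := hasDerivWithinAt_iff_tendsto_slope.1 (hGt t ht x)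
    have l3 := (hc₁ x).tendsto.mono_left (nhdsWithin_mono t (sdiff_subset (t := {t})))
    have l4 := (hc₂ x).tendsto.mono_left (nhdsWithin_mono t (sdiff_subset (t := {t})))
    have := ((l1.const_mul (-(1/2))).mul (((l4.add_const (v₂ t x)).mul_const (g x)).add
      ((l3.add_const (v₁ t x)).mul_const (g₁ x)))).sub (l2.mul_const (g x))
    refine (this.congr fun s => ?_).trans_eq ?_
    · simp only [Q, slope_def_module, smul_eq_mul]
      ring
    · congr 1
      ring

lemma deriv_deriv_eq_iteratedDeriv (f : ℝ → ℝ) : deriv (deriv f) = iteratedDeriv 2 f := by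
  simp [iteratedDeriv_succ, iteratedDeriv_zero]

lemma deriv_deriv_deriv_eq_iteratedDeriv (f : ℝ → ℝ) :
    deriv (deriv (deriv f)) = iteratedDeriv 3 f := by
  simp [iteratedDeriv_succ, iteratedDeriv_zero]

/-- Kato's localized energy identity for the gKdV equation: for a smooth,
rapidly decaying solution `u` and a smooth weight `g` bounded together with its derivatives
up to order three, the localized energy `∫ ((1/2)(∂ₓu)² - (1/(p+1))|u|^{p+1}) g dx` is
differentiable in time with the stated derivative. -/
theorem gKdV_kato_localized_energy_identity (p : ℝ) (hp : 1 < p) (T : EReal) (hT : 0 < T)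
    (u : ℝ → ℝ → ℝ)
    (hsmooth : ContDiffOn ℝ (⊤:ℕ∞) (fun q : ℝ × ℝ => u q.1 q.2) (timeDomain T ×ˢ univ))
    (hdecay : RapidDecayLocUnif T u)
    (hsol : IsGKdVSolution p T u)
    (g : ℝ → ℝ) (hg : ContDiff ℝ (⊤:ℕ∞) g)
    (hgbd : ∀ k : ℕ, k ≤ 3 → ∃ C : ℝ, ∀ x : ℝ, |iteratedDeriv k g x| ≤ C) :
    ∀ t ∈ timeDomain T,
      HasDerivWithinAt
        (fun s => ∫ x : ℝ, ((1/2) * (deriv (u s) x) ^ 2 - (1/(p+1)) * |u s x| ^ (p+1)) * g x)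
        (-(1/2) * (∫ x : ℝ, (deriv (deriv (u t)) x + u t x * |u t x| ^ (p-1)) ^ 2 * deriv g x)
          - (∫ x : ℝ, (deriv (deriv (u t)) x) ^ 2 * deriv g x)
          + p * (∫ x : ℝ, |u t x| ^ (p-1) * (deriv (u t) x) ^ 2 * deriv g x)
          + (1/2) * (∫ x : ℝ, (deriv (u t) x) ^ 2 * iteratedDeriv 3 g x))
        (timeDomain T) t := by
  intro t ht
  have hU := uniqueDiffOn_timeDomain hT
  have h1 := contDiffOn_deriv_snd hU hsmooth
  have h2 := contDiffOn_deriv_snd (v := fun t => deriv (u t)) hU h1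
  have h3 := contDiffOn_deriv_snd (v := fun t => deriv (deriv (u t))) hU h2
  have hder {f : ℝ → ℝ} (hf : ContDiff ℝ (⊤:ℕ∞) f) (x : ℝ) : HasDerivAt f (deriv f x) x :=
    (hf.differentiable (by simp) x).hasDerivAt
  have c0 : ∀ s ∈ timeDomain T, ContDiff ℝ (⊤:ℕ∞) (u s) := fun s hs => contDiff_slice hsmooth hs
  have c1 : ∀ s ∈ timeDomain T, ContDiff ℝ (⊤:ℕ∞) (deriv (u s)) := fun s hs =>
    contDiff_slice (v := fun t => deriv (u t)) h1 hs
  have c2 : ∀ s ∈ timeDomain T, ContDiff ℝ (⊤:ℕ∞) (deriv (deriv (u s))) := fun s hs =>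
    contDiff_slice (v := fun t => deriv (deriv (u t))) h2 hs
  have c3 : ∀ s ∈ timeDomain T, ContDiff ℝ (⊤:ℕ∞) (deriv (deriv (deriv (u s)))) := fun s hs =>
    contDiff_slice (v := fun t => deriv (deriv (deriv (u t)))) h3 hs
  have bg (k : ℕ) (hk : k ≤ 3) : IsContBounded (iteratedDeriv k g) :=
    ⟨hg.continuous_iteratedDeriv k (by exact_mod_cast le_top), hgbd k hk⟩
  have b0 : IsContBounded g := by simpa using bg 0 (by norm_num)
  have b1 : IsContBounded (deriv g) := by simpa using bg 1 (by norm_num)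
  have b2 : IsContBounded (iteratedDeriv 2 g) := bg 2 (by norm_num)
  have b3 : IsContBounded (iteratedDeriv 3 g) := bg 3 le_rfl
  have dg {k : ℕ} (x : ℝ) : HasDerivAt (iteratedDeriv k g) (iteratedDeriv (k + 1) g x) x := by
    rw [iteratedDeriv_succ]
    exact (hg.differentiable_iteratedDeriv k (by exact_mod_cast WithTop.coe_lt_top _) x).hasDerivAt
  have dg0 (x : ℝ) : HasDerivAt g (deriv g x) x := hder hg x
  have dg1 (x : ℝ) : HasDerivAt (deriv g) (iteratedDeriv 2 g x) x := by
    simpa using dg (k := 1) x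
  obtain ⟨ε, hε, K, hK, hbd⟩ := hdecay.exists_uniform_bound ht 4
  have e0 : ∀ s ∈ timeDomain T, |s - t| < ε → ∀ x, |u s x| ≤ K * (1 + x ^ 2)⁻¹ :=
    fun s hs hst x => by simpa using hbd s hs hst 0 (by norm_num) x
  have e1 : ∀ s ∈ timeDomain T, |s - t| < ε → ∀ x, |deriv (u s) x| ≤ K * (1 + x ^ 2)⁻¹ :=
    fun s hs hst x => by simpa using hbd s hs hst 1 (by norm_num) x
  have e2 : ∀ s ∈ timeDomain T, |s - t| < ε → ∀ x,
      |deriv (deriv (u s)) x| ≤ K * (1 + x ^ 2)⁻¹ := fun s hs hst x => by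
    rw [deriv_deriv_eq_iteratedDeriv]
    exact hbd s hs hst 2 (by norm_num) x
  have e3 : ∀ s ∈ timeDomain T, |s - t| < ε → ∀ x,
      |deriv (deriv (deriv (u s))) x| ≤ K * (1 + x ^ 2)⁻¹ := fun s hs hst x => by
    rw [deriv_deriv_deriv_eq_iteratedDeriv]
    exact hbd s hs hst 3 (by norm_num) x
  have htt : |t - t| < ε := by simpa using hε
  let L : ℝ := K + p * K ^ (p - 1) * K
  have hKL : K ≤ L := le_add_of_nonneg_right (by positivity)
  have hL : ∀ x : ℝ, K * (1 + x ^ 2)⁻¹ ≤ L * (1 + x ^ 2)⁻¹ := fun x =>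
    mul_le_mul_of_nonneg_right hKL (by positivity)
  have et : ∀ s ∈ timeDomain T, |s - t| < ε → ∀ x,
      |-(deriv (deriv (deriv (u s))) x + p * |u s x| ^ (p - 1) * deriv (u s) x)|
        ≤ L * (1 + x ^ 2)⁻¹ := by
    intro s hs hst x
    rw [abs_neg]
    refine (abs_add_le _ _).trans ?_
    rw [abs_mul, abs_mul, abs_of_pos (by linarith : 0 < p),
      abs_of_nonneg (Real.rpow_nonneg (abs_nonneg _) _)]
    have hr : |u s x| ^ (p - 1) ≤ K ^ (p - 1) :=
      Real.rpow_le_rpow (abs_nonneg _)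
        ((e0 s hs hst x).trans (mul_le_of_le_one_right hK (inv_one_add_sq_le_one x)))
        (by linarith)
    calc _ ≤ K * (1 + x ^ 2)⁻¹ + p * K ^ (p - 1) * (K * (1 + x ^ 2)⁻¹) := by
          have := e3 s hs hst x
          have := e1 s hs hst x
          gcongr
      _ = L * (1 + x ^ 2)⁻¹ := by
          simp only [L]
          ring
  have main := hasDerivWithinAt_localized_energy hp (convex_timeDomain T)
    (v₁ := fun s => deriv (u s)) (v₂ := fun s => deriv (deriv (u s))) ht hε
    (fun s hs x => hsol.hasDerivWithinAt hp hT hsmooth hs x)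
    (fun s hs x => hder (c0 s hs) x) (fun s hs x => hder (c1 s hs) x)
    (fun s hs => (c2 s hs).continuous)
    (fun x => continuousOn_fst_slice (v := fun s => deriv (u s)) h1 x t ht)
    (fun x => continuousOn_fst_slice (v := fun s => deriv (deriv (u s))) h2 x t ht)
    dg0 b0 b1
    (fun s hs hst x => (e0 s hs hst x).trans (hL x))
    (fun s hs hst x => (e1 s hs hst x).trans (hL x))
    (fun s hs hst x => (e2 s hs hst x).trans (hL x)) et
  refine main.congr_deriv ?_
  rw [← integral_localized_energy_flux hp (hder (c0 t ht)) (hder (c1 t ht)) (hder (c2 t ht))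
    dg0 dg1 dg ⟨(c0 t ht).continuous, K, e0 t ht htt⟩
    ⟨(c1 t ht).continuous, K, e1 t ht htt⟩ ⟨(c2 t ht).continuous, K, e2 t ht htt⟩
    ⟨(c3 t ht).continuous, K, e3 t ht htt⟩ b0 b1 b2 b3]
  refine integral_congr_ae (Eventually.of_forall fun x => ?_)
  simp only
  ring

end
end
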